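/- arXiv:2211.10913 — 2 statements merged into one kernel-verified Lean document; each statement's English description precedes it below -/
import Mathlib

section
/- For a fixed prime n₀ and real numbers ρ⁻ < ρ⁺, liminf_{n→∞} Ψ(n; ρ⁻, ρ⁺)/n² ≥ (ρ⁺ − ρ⁻)·(3/π²)·(1 − 1/n₀), where Ψ(n; ρ⁻, ρ⁺) counts irreducible fractions p/q in (ρ⁻, ρ⁺) with q ≤ n and q coprime to n₀. -/
open Filter Real

/-- Ψ(n; ρ⁻, ρ⁺): the number of irreducible fractions `p/q` with `ρ⁻ < p/q < ρ⁺`,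
`q ≤ n`, and `q` coprime to `n₀`. -/
noncomputable def PsiInterval (n₀ n : ℕ) (ρm ρp : ℝ) : ℕ :=
  {q : ℚ | ρm < (q : ℝ) ∧ (q : ℝ) < ρp ∧ q.den ≤ n ∧ Nat.Coprime q.den n₀}.ncard

open ArithmeticFunction in
/-- Möbius inversion for the constant function one, in indicator form. -/
lemma sum_moebius_dvd_eq_ite {n : ℕ} (g : ℕ) (hg : g ≠ 0) (hgn : g ≤ n) :
    ∑ d ∈ Finset.Icc 1 n with d ∣ g, moebius d = if g = 1 then 1 else 0 := by
  have hdiv : (Finset.Icc 1 n).filter (· ∣ g) = g.divisors := by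
    ext d
    simp only [Finset.mem_filter, Finset.mem_Icc, Nat.mem_divisors]
    refine ⟨fun h => ⟨h.2, hg⟩, fun h => ⟨⟨Nat.pos_of_dvd_of_pos h.1 (Nat.pos_of_ne_zero hg),
      (Nat.le_of_dvd (Nat.pos_of_ne_zero hg) h.1).trans hgn⟩, h.1⟩⟩
  rw [hdiv, ← coe_mul_zeta_apply, moebius_mul_coe_zeta, one_apply]

lemma tendsto_natDiv_div (d : ℕ) :
    Tendsto (fun n : ℕ => ((n / d : ℕ) : ℝ) / (n : ℝ)) atTop (nhds (1 / d)) := by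
  have h := (tendsto_nat_floor_mul_div_atTop (R := ℝ) (a := 1 / (d : ℝ)) (by positivity)).comp
    tendsto_natCast_atTop_atTop
  refine h.congr fun n => ?_
  simp only [Function.comp_apply]
  rw [one_div_mul_eq_div, Nat.floor_div_eq_div]

lemma sum_coprime_add_sum_multiples {p : ℕ} (hp : p.Prime) (m : ℕ) :
    ∑ q ∈ Finset.Icc 1 m with q.Coprime p, q + p * ∑ j ∈ Finset.Icc 1 (m / p), j
      = ∑ q ∈ Finset.Icc 1 m, q := by
  induction m with
  | zero => simp
  | succ m ih =>
    rw [← Finset.insert_Icc_right_eq_Icc_add_one (by omega), Finset.filter_insert,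
      Finset.sum_insert (by simp), Nat.succ_div]
    by_cases hd : p ∣ m + 1
    · have hc : ¬ (m + 1).Coprime p := by
        rwa [Nat.coprime_comm, hp.coprime_iff_not_dvd, not_not]
      have hk : p * (m / p + 1) = m + 1 := by
        have := Nat.mul_div_cancel' hd
        rwa [Nat.succ_div, if_pos hd] at this
      rw [if_neg hc, if_pos hd, Finset.sum_Icc_succ_top (Nat.le_add_left 1 _), mul_add, hk]
      omega
    · have hc : (m + 1).Coprime p := by
        rwa [Nat.coprime_comm, hp.coprime_iff_not_dvd]
      rw [if_pos hc, if_neg hd, Finset.sum_insert (by simp)]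
      simp only [add_zero]
      omega

lemma sum_Icc_one_id_real (m : ℕ) :
    ((∑ q ∈ Finset.Icc 1 m, q : ℕ) : ℝ) = m * (m + 1) / 2 := by
  induction m with
  | zero => simp
  | succ m ih =>
    rw [Finset.sum_Icc_succ_top (by omega), Nat.cast_add, ih]
    push_cast
    ring

lemma tendsto_sum_coprime_div_sq {p : ℕ} (hp : p.Prime) :
    Tendsto (fun m : ℕ => ((∑ q ∈ Finset.Icc 1 m with q.Coprime p, q : ℕ) : ℝ) / (m : ℝ) ^ 2)
      atTop (nhds ((1 - 1 / (p : ℝ)) / 2)) := by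
  have hp0 : (p : ℝ) ≠ 0 := by exact_mod_cast hp.ne_zero
  have hk := tendsto_natDiv_div p
  have hm := tendsto_one_div_atTop_nhds_zero_nat (𝕜 := ℝ)
  have key : Tendsto (fun m : ℕ => (1 + 1 / (m : ℝ)) / 2
      - p * ((((m / p : ℕ) : ℝ) / m) * (((m / p : ℕ) : ℝ) / m + 1 / m)) / 2) atTop
      (nhds ((1 + 0) / 2 - p * ((1 / (p : ℝ)) * (1 / p + 0)) / 2)) :=
    ((hm.const_add 1).div_const 2).sub (((hk.mul (hk.add hm)).const_mul (p : ℝ)).div_const 2)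
  have hlim : (1 + 0) / 2 - (p : ℝ) * ((1 / (p : ℝ)) * (1 / p + 0)) / 2
      = (1 - 1 / (p : ℝ)) / 2 := by
    field_simp
    ring
  rw [hlim] at key
  refine key.congr' ?_
  filter_upwards [eventually_ge_atTop 1] with m hm1
  have hm0 : (m : ℝ) ≠ 0 := by positivity
  have hs := congrArg (Nat.cast (R := ℝ)) (sum_coprime_add_sum_multiples hp m)
  rw [Nat.cast_add, Nat.cast_mul, sum_Icc_one_id_real, sum_Icc_one_id_real] at hs
  rw [eq_sub_of_add_eq hs]
  field_simp

/-- The lattice points `(q, a)` of the triangle `ρm * q < a < ρp * q`, `1 ≤ q ≤ n`,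
whose first coordinate is coprime to `N`. -/
noncomputable def trianglePoints (N : ℕ) (ρm ρp : ℝ) (n : ℕ) : Finset ((_ : ℕ) × ℤ) :=
  ((Finset.Icc 1 n).filter (·.Coprime N)).sigma
    fun q => Finset.Ioo ⌊ρm * (q : ℝ)⌋ ⌈ρp * (q : ℝ)⌉

lemma mem_trianglePoints {N : ℕ} {ρm ρp : ℝ} {n : ℕ} {x : (_ : ℕ) × ℤ} :
    x ∈ trianglePoints N ρm ρp n ↔ ((1 ≤ x.1 ∧ x.1 ≤ n) ∧ x.1.Coprime N) ∧
      ρm * (x.1 : ℝ) < x.2 ∧ (x.2 : ℝ) < ρp * (x.1 : ℝ) := by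
  simp [trianglePoints, Int.floor_lt, Int.lt_ceil]

lemma abs_card_Ioo_floor_ceil_sub_le {x y : ℝ} (hxy : x ≤ y) :
    |((Finset.Ioo ⌊x⌋ ⌈y⌉).card : ℝ) - (y - x)| ≤ 1 := by
  have h1 := Int.floor_le x
  have h2 := Int.lt_floor_add_one x
  have h3 := Int.le_ceil y
  have h4 := Int.ceil_lt_add_one y
  rw [Int.card_Ioo]
  by_cases hle : 0 ≤ ⌈y⌉ - ⌊x⌋ - 1
  · have hc : (((⌈y⌉ - ⌊x⌋ - 1).toNat : ℕ) : ℝ) = ⌈y⌉ - ⌊x⌋ - 1 := by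
      have := congrArg (Int.cast (R := ℝ)) (Int.toNat_of_nonneg hle)
      push_cast at this
      exact_mod_cast this
    rw [hc, abs_le]
    constructor <;> linarith
  · have hc : (⌈y⌉ : ℝ) ≤ ⌊x⌋ := by exact_mod_cast (by omega : ⌈y⌉ ≤ ⌊x⌋)
    rw [Int.toNat_of_nonpos (by omega), abs_le]
    constructor <;> push_cast <;> linarith

lemma abs_card_trianglePoints_sub_le (N : ℕ) {ρm ρp : ℝ} (h : ρm < ρp) (n : ℕ) :
    |((trianglePoints N ρm ρp n).card : ℝ)
      - (ρp - ρm) * ((∑ q ∈ Finset.Icc 1 n with q.Coprime N, q : ℕ) : ℝ)| ≤ n := by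
  rw [trianglePoints, Finset.card_sigma]
  push_cast
  rw [Finset.mul_sum, ← Finset.sum_sub_distrib]
  refine (Finset.abs_sum_le_sum_abs _ _).trans ?_
  have hb : ∀ q ∈ (Finset.Icc 1 n).filter (·.Coprime N),
      |((Finset.Ioo ⌊ρm * (q : ℝ)⌋ ⌈ρp * (q : ℝ)⌉).card : ℝ) - (ρp - ρm) * q| ≤ 1 := by
    intro q _
    rw [sub_mul]
    exact abs_card_Ioo_floor_ceil_sub_le (by gcongr)
  refine (Finset.sum_le_card_nsmul _ _ _ hb).trans ?_
  rw [nsmul_eq_mul, mul_one]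
  exact_mod_cast (Finset.card_filter_le _ _).trans (by simp)

lemma card_trianglePoints_le (N : ℕ) {ρm ρp : ℝ} (h : ρm < ρp) (n : ℕ) :
    ((trianglePoints N ρm ρp n).card : ℝ) ≤ (ρp - ρm + 1) * (n : ℝ) ^ 2 := by
  have h1 := (abs_le.mp (abs_card_trianglePoints_sub_le N h n)).2
  have h2 : ((∑ q ∈ Finset.Icc 1 n with q.Coprime N, q : ℕ) : ℝ) ≤ (n : ℝ) ^ 2 := by
    have : ∑ q ∈ Finset.Icc 1 n with q.Coprime N, q ≤ n ^ 2 := by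
      refine (Finset.sum_le_card_nsmul _ _ n fun q hq => ?_).trans ?_
      · exact (Finset.mem_Icc.mp (Finset.mem_filter.mp hq).1).2
      · rw [smul_eq_mul, sq]
        exact Nat.mul_le_mul_right _ ((Finset.card_filter_le _ _).trans (by simp))
    exact_mod_cast this
  have h3 : (n : ℝ) ≤ (n : ℝ) ^ 2 := by exact_mod_cast Nat.le_self_pow two_ne_zero n
  nlinarith [mul_le_mul_of_nonneg_left h2 (sub_pos.mpr h).le]

lemma tendsto_card_trianglePoints_div_sq {p : ℕ} (hp : p.Prime) {ρm ρp : ℝ} (h : ρm < ρp) :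
    Tendsto (fun n : ℕ => ((trianglePoints p ρm ρp n).card : ℝ) / (n : ℝ) ^ 2) atTop
      (nhds ((ρp - ρm) * ((1 - 1 / (p : ℝ)) / 2))) := by
  have hmain := (tendsto_sum_coprime_div_sq hp).const_mul (ρp - ρm)
  have herr : Tendsto (fun n : ℕ => (((trianglePoints p ρm ρp n).card : ℝ)
      - (ρp - ρm) * ((∑ q ∈ Finset.Icc 1 n with q.Coprime p, q : ℕ) : ℝ)) / (n : ℝ) ^ 2)
      atTop (nhds 0) := by
    refine squeeze_zero_norm (fun n => ?_) (tendsto_one_div_atTop_nhds_zero_nat (𝕜 := ℝ))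
    rw [norm_div, Real.norm_eq_abs, norm_pow, Real.norm_natCast]
    rcases Nat.eq_zero_or_pos n with rfl | hn
    · simp
    · have hn0 : (0 : ℝ) < n := by exact_mod_cast hn
      rw [div_le_div_iff₀ (by positivity) hn0, one_mul, sq]
      exact mul_le_mul_of_nonneg_right (abs_card_trianglePoints_sub_le p h n) hn0.le
  have := herr.add hmain
  rw [zero_add] at this
  refine this.congr fun n => ?_
  ring

lemma PsiInterval_eq_card (N n : ℕ) (ρm ρp : ℝ) :
    PsiInterval N n ρm ρp
      = ((trianglePoints N ρm ρp n).filter fun x => x.2.gcd x.1 = 1).card := by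
  rw [PsiInterval, ← Set.ncard_coe_finset]
  refine Set.ncard_congr (fun q _ => ⟨q.den, q.num⟩) ?_ ?_ ?_
  · rintro q ⟨h1, h2, h3, h4⟩
    have hd : (0 : ℝ) < q.den := by exact_mod_cast q.den_pos
    rw [Rat.cast_def] at h1 h2
    rw [lt_div_iff₀ hd] at h1
    rw [div_lt_iff₀ hd] at h2
    simp only [Finset.coe_filter, Set.mem_ofPred_eq, mem_trianglePoints]
    exact ⟨⟨⟨⟨q.den_pos, h3⟩, h4⟩, h1, h2⟩, by simpa [Int.gcd] using q.reduced⟩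
  · intro a b _ _ hab
    simp only [Sigma.mk.injEq, heq_eq_eq] at hab
    exact Rat.ext hab.2 hab.1
  · rintro ⟨d, a⟩ hx
    simp only [Finset.coe_filter, Set.mem_ofPred_eq, mem_trianglePoints] at hx
    obtain ⟨⟨⟨⟨h0, h1⟩, h2⟩, h3, h4⟩, h5⟩ := hx
    have hd : (0 : ℝ) < d := by exact_mod_cast h0
    refine ⟨⟨a, d, by omega, by simpa [Int.gcd] using h5⟩, ?_, rfl⟩
    simp only [Set.mem_ofPred_eq, Rat.cast_def]
    exact ⟨(lt_div_iff₀ hd).2 h3, (div_lt_iff₀ hd).2 h4, h1, h2⟩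

lemma card_trianglePoints_filter_dvd (N n d : ℕ) (hd : 1 ≤ d) (ρm ρp : ℝ) :
    ((trianglePoints N ρm ρp n).filter fun x => d ∣ x.2.gcd x.1).card
      = if d.Coprime N then (trianglePoints N ρm ρp (n / d)).card else 0 := by
  have hdR : (0 : ℝ) < d := by exact_mod_cast hd
  split_ifs with hdN
  · symm
    refine Finset.card_bij (fun x _ => ⟨d * x.1, d * x.2⟩) ?_ ?_ ?_
    · rintro ⟨q, a⟩ hx
      rw [mem_trianglePoints] at hx
      simp only [Finset.mem_filter, mem_trianglePoints]
      obtain ⟨⟨⟨h0, h1⟩, h2⟩, h3, h4⟩ := hx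
      refine ⟨⟨⟨⟨Nat.mul_pos hd h0, ?_⟩, hdN.mul_left h2⟩, ?_, ?_⟩, ?_⟩
      · rw [mul_comm]
        exact (Nat.le_div_iff_mul_le hd).1 h1
      · push_cast
        nlinarith [mul_lt_mul_of_pos_left h3 hdR]
      · push_cast
        nlinarith [mul_lt_mul_of_pos_left h4 hdR]
      · exact Int.dvd_gcd (dvd_mul_right _ _) (by push_cast; exact dvd_mul_right _ _)
    · rintro ⟨q, a⟩ _ ⟨q', a'⟩ _ hab
      simp only [Sigma.mk.injEq, heq_eq_eq] at hab
      have h1 := Nat.eq_of_mul_eq_mul_left hd hab.1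
      have h2 := mul_left_cancel₀ (by exact_mod_cast (by omega : d ≠ 0)) hab.2
      rw [h1, h2]
    · rintro ⟨q, a⟩ hx
      simp only [Finset.mem_filter, mem_trianglePoints] at hx
      obtain ⟨⟨⟨⟨h0, h1⟩, h2⟩, h3, h4⟩, h5⟩ := hx
      obtain ⟨a', rfl⟩ : (d : ℤ) ∣ a := (Int.natCast_dvd_natCast.2 h5).trans (Int.gcd_dvd_left _ _)
      obtain ⟨q', rfl⟩ : d ∣ q :=
        Int.natCast_dvd_natCast.1 ((Int.natCast_dvd_natCast.2 h5).trans (Int.gcd_dvd_right _ _))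
      refine ⟨⟨q', a'⟩, ?_, rfl⟩
      rw [mem_trianglePoints]
      push_cast at h3 h4
      refine ⟨⟨⟨Nat.pos_of_mul_pos_left h0, ?_⟩, h2.coprime_mul_left⟩, ?_, ?_⟩
      · rw [Nat.le_div_iff_mul_le hd, mul_comm]
        exact h1
      · refine lt_of_mul_lt_mul_left ?_ hdR.le
        linarith
      · refine lt_of_mul_lt_mul_left ?_ hdR.le
        linarith
  · rw [Finset.card_eq_zero, Finset.filter_eq_empty_iff]
    rintro ⟨q, a⟩ hx hdvd
    rw [mem_trianglePoints] at hx
    refine hdN (hx.1.2.coprime_dvd_left ?_)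
    exact Int.natCast_dvd_natCast.1
      ((Int.natCast_dvd_natCast.2 hdvd).trans (Int.gcd_dvd_right _ _))

open ArithmeticFunction in
lemma PsiInterval_eq_sum_moebius (N n : ℕ) (ρm ρp : ℝ) :
    (PsiInterval N n ρm ρp : ℤ) = ∑ d ∈ Finset.Icc 1 n,
      moebius d * if d.Coprime N then ((trianglePoints N ρm ρp (n / d)).card : ℤ) else 0 := by
  have hinv : ∀ x ∈ trianglePoints N ρm ρp n, (if x.2.gcd x.1 = 1 then (1 : ℤ) else 0)
      = ∑ d ∈ Finset.Icc 1 n, if d ∣ x.2.gcd x.1 then moebius d else 0 := by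
    intro x hx
    obtain ⟨⟨⟨h0, h1⟩, -⟩, -⟩ := mem_trianglePoints.1 hx
    rw [← Finset.sum_filter, sum_moebius_dvd_eq_ite]
    · rw [Ne, Int.gcd_eq_zero_iff]
      omega
    · refine (Nat.le_of_dvd h0 ?_).trans h1
      exact Int.natCast_dvd_natCast.1 (Int.gcd_dvd_right _ _)
  rw [PsiInterval_eq_card, Finset.card_filter]
  push_cast
  rw [Finset.sum_congr rfl hinv, Finset.sum_comm]
  refine Finset.sum_congr rfl fun d hd => ?_
  have hcard := card_trianglePoints_filter_dvd N n d (Finset.mem_Icc.1 hd).1 ρm ρp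
  rw [← Finset.sum_filter, Finset.sum_const, nsmul_eq_mul, hcard, mul_comm]
  push_cast
  rfl

open ArithmeticFunction in
lemma tsum_moebius_coprime_div_sq {p : ℕ} (hp : p.Prime) :
    ∑' d : ℕ, (if d.Coprime p then (moebius d : ℝ) / (d : ℝ) ^ 2 else 0)
      = 6 / π ^ 2 / (1 - 1 / (p : ℝ) ^ 2) := by
  have : NeZero p := ⟨hp.ne_zero⟩
  have hs : 1 < (2 : ℂ).re := by norm_num
  have hmul := DirichletCharacter.LSeries.mul_mu_eq_one (1 : DirichletCharacter ℂ p) hs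
  have hL := DirichletCharacter.LFunctionTrivChar_eq_mul_riemannZeta (N := p) (s := 2)
    (by norm_num)
  rw [DirichletCharacter.LFunctionTrivChar, DirichletCharacter.LFunction_eq_LSeries _ hs,
    hp.primeFactors, Finset.prod_singleton, riemannZeta_two] at hL
  rw [hL] at hmul
  have hterm : LSeries ((fun n : ℕ => (1 : DirichletCharacter ℂ p) n) *
      fun n : ℕ => (moebius n : ℂ)) 2 = ((∑' d : ℕ, (if d.Coprime p then (moebius d : ℝ) / (d : ℝ) ^ 2 else 0) : ℝ) : ℂ) := by
    rw [LSeries, Complex.ofReal_tsum]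
    refine tsum_congr fun d => ?_
    rcases eq_or_ne d 0 with rfl | hd
    · simp
    · rw [LSeries.term_of_ne_zero hd]
      split_ifs with hc
      · simp [MulChar.one_apply ((ZMod.isUnit_iff_coprime d p).2 hc)]
      · simp [MulChar.map_nonunit _ (mt (ZMod.isUnit_iff_coprime d p).1 hc)]
  rw [hterm, Complex.cpow_neg, Complex.cpow_ofNat] at hmul
  generalize ∑' d : ℕ, (if d.Coprime p then (moebius d : ℝ) / (d : ℝ) ^ 2 else 0) = B at hmul ⊢
  have hreal : (1 - ((p : ℝ) ^ 2)⁻¹) * (π ^ 2 / 6) * B = 1 := by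
    apply Complex.ofReal_injective
    push_cast
    exact hmul
  rw [div_div, eq_div_iff_mul_eq, ← mul_right_cancel_iff_of_pos (show (0 : ℝ) < 1 / 6 by norm_num)]
  · rw [one_div ((p : ℝ) ^ 2)]
    linarith
  · intro h0
    rw [one_div, mul_comm] at h0
    rw [← mul_div_assoc, h0] at hreal
    simp at hreal

open ArithmeticFunction in
lemma tendsto_PsiInterval_div_sq {p : ℕ} (hp : p.Prime) {ρm ρp : ℝ} (h : ρm < ρp) :
    Tendsto (fun n : ℕ => (PsiInterval p n ρm ρp : ℝ) / (n : ℝ) ^ 2) atTop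
      (nhds ((ρp - ρm) * ((1 - 1 / (p : ℝ)) / 2) * (6 / π ^ 2 / (1 - 1 / (p : ℝ) ^ 2)))) := by
  set c := (ρp - ρm) * ((1 - 1 / (p : ℝ)) / 2) with hc
  let f : ℕ → ℕ → ℝ := fun n d => if d.Coprime p then
    (moebius d : ℝ) * ((trianglePoints p ρm ρp (n / d)).card / (n : ℝ) ^ 2) else 0
  have hempty : trianglePoints p ρm ρp 0 = ∅ := by simp [trianglePoints]
  have hf : ∀ n : ℕ, (PsiInterval p n ρm ρp : ℝ) / (n : ℝ) ^ 2 = ∑' d, f n d := by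
    intro n
    rw [tsum_eq_sum (s := Finset.Icc 1 n)]
    · have := congrArg (Int.cast (R := ℝ)) (PsiInterval_eq_sum_moebius p n ρm ρp)
      push_cast at this
      rw [this, Finset.sum_div]
      refine Finset.sum_congr rfl fun d _ => ?_
      simp only [f]
      split_ifs <;> simp [mul_div_assoc]
    · intro d hd
      have h0 : n / d = 0 := by
        rw [Nat.div_eq_zero_iff]
        rw [Finset.mem_Icc] at hd
        omega
      simp [f, h0, hempty]
  have hμ : ∀ d : ℕ, |(moebius d : ℝ)| ≤ 1 := fun d => by
    exact_mod_cast abs_moebius_le_one (n := d)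
  have hdom := tendsto_tsum_of_dominated_convergence (𝓕 := atTop) (f := f)
    (g := fun d => c * if d.Coprime p then (moebius d : ℝ) / (d : ℝ) ^ 2 else 0)
    (bound := fun d => (ρp - ρm + 1) * (1 / (d : ℝ) ^ 2))
    ((Real.summable_one_div_nat_pow.2 one_lt_two).mul_left _) ?_ ?_
  · rw [tsum_mul_left, tsum_moebius_coprime_div_sq hp] at hdom
    exact hdom.congr fun n => (hf n).symm
  · intro d
    simp only [f]
    split_ifs with hd
    · have hd0 : d ≠ 0 := by
        rintro rfl
        exact hp.one_lt.ne' (by simpa using hd)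
      have h1 := (tendsto_card_trianglePoints_div_sq hp h).comp
        (Nat.tendsto_div_const_atTop hd0)
      have h2 := ((h1.mul ((tendsto_natDiv_div d).pow 2)).const_mul (moebius d : ℝ))
      have hlim : (moebius d : ℝ) * (c * (1 / (d : ℝ)) ^ 2) = c * (moebius d / (d : ℝ) ^ 2) := by
        ring
      rw [← hc, hlim] at h2
      refine h2.congr' ?_
      filter_upwards [eventually_ge_atTop d] with n hn
      have hnd : (0 : ℝ) < ((n / d : ℕ) : ℝ) := by
        exact_mod_cast Nat.div_pos hn (Nat.pos_of_ne_zero hd0)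
      simp only [Function.comp_apply]
      field_simp
    · simp
  · refine Eventually.of_forall fun n d => ?_
    have hL : 0 ≤ ρp - ρm + 1 := by linarith
    simp only [f]
    split_ifs with hd
    · rw [norm_mul, Real.norm_eq_abs, Real.norm_of_nonneg (by positivity)]
      refine (mul_le_of_le_one_left (by positivity) (hμ d)).trans ?_
      refine (div_le_div_of_nonneg_right (card_trianglePoints_le p h _) (by positivity)).trans ?_
      rw [mul_div_assoc]
      refine mul_le_mul_of_nonneg_left ?_ hL
      rcases Nat.eq_zero_or_pos n with rfl | hn
      · simp
      · have hn0 : (0 : ℝ) < n := by exact_mod_cast hn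
        rw [div_le_iff₀ (by positivity), one_div_mul_eq_div, ← div_pow]
        gcongr
        exact Nat.cast_div_le
    · rw [norm_zero]
      positivity

theorem PsiInterval_liminf_lower_bound (n₀ : ℕ) (hn₀ : n₀.Prime) (ρm ρp : ℝ) (h : ρm < ρp) :
    (ρp - ρm) * (3 / π ^ 2) * (1 - 1 / (n₀ : ℝ))
      ≤ liminf (fun n : ℕ => (PsiInterval n₀ n ρm ρp : ℝ) / (n : ℝ) ^ 2) atTop := by
  rw [(tendsto_PsiInterval_div_sq hn₀ h).liminf_eq]
  have hp : (1 : ℝ) < n₀ := by exact_mod_cast hn₀.one_lt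
  have h1 : 0 < 1 - 1 / (n₀ : ℝ) := by
    rw [sub_pos, div_lt_one (by linarith)]
    exact hp
  have h2 : 0 < 1 - 1 / (n₀ : ℝ) ^ 2 := by
    rw [sub_pos, div_lt_one (by positivity)]
    nlinarith
  have h3 : 6 / π ^ 2 ≤ 6 / π ^ 2 / (1 - 1 / (n₀ : ℝ) ^ 2) := by
    refine le_div_self (by positivity) h2 ?_
    rw [sub_le_self_iff]
    positivity
  calc (ρp - ρm) * (3 / π ^ 2) * (1 - 1 / (n₀ : ℝ))
      = (ρp - ρm) * ((1 - 1 / (n₀ : ℝ)) / 2) * (6 / π ^ 2) := by ring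
    _ ≤ _ := mul_le_mul_of_nonneg_left h3 (mul_nonneg (sub_pos.2 h).le (by positivity))
end

section
/- liminf_{n→∞} φ(n)·(log log n)/n = e^{−γ}, where γ is the Euler–Mascheroni constant. -/
open Filter Real
open scoped Topology

theorem log_factorial_eq_sum_primesLE (n : ℕ) :
    log (n.factorial : ℝ) =
      ∑ p ∈ Nat.primesLE n, (n.factorial.factorization p : ℝ) * log p := by
  rw [Real.log_nat_eq_sum_factorization]
  refine Finsupp.sum_of_support_subset _ (fun p hp => ?_) _ (by simp)
  have hp' := Nat.prime_of_mem_primeFactors hp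
  exact Nat.mem_primesLE.2
    ⟨hp'.dvd_factorial.1 (Nat.dvd_of_mem_primeFactors hp), hp'⟩

theorem div_le_factorization_factorial {p : ℕ} (hp : p.Prime) (n : ℕ) :
    n / p ≤ n.factorial.factorization p := by
  rw [Nat.factorization_factorial hp (b := Nat.log p n + 2) (by omega)]
  simpa using Finset.single_le_sum (f := fun i => n / p ^ i) (fun i _ => Nat.zero_le _)
    (show 1 ∈ Finset.Ico 1 (Nat.log p n + 2) by simp)

theorem sum_primesLE_log_div_le {n : ℕ} (hn : n ≠ 0) :
    ∑ p ∈ Nat.primesLE n, log p / p ≤ log n + log 4 := by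
  have hn' : (0 : ℝ) < n := by positivity
  have h1 : ∑ p ∈ Nat.primesLE n, ((n : ℝ) / p - 1) * log p ≤ log (n.factorial : ℝ) := by
    rw [log_factorial_eq_sum_primesLE]
    refine Finset.sum_le_sum fun p hp => ?_
    have hp' := Nat.prime_of_mem_primesLE hp
    have : ((n / p : ℕ) : ℝ) ≤ n.factorial.factorization p :=
      mod_cast div_le_factorization_factorial hp' n
    have h2 := (Nat.sub_one_lt_floor ((n : ℝ) / p)).le
    rw [Nat.floor_div_natCast, Nat.floor_natCast] at h2
    exact mul_le_mul_of_nonneg_right (h2.trans this) (log_natCast_nonneg p)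
  have h2 : log (n.factorial : ℝ) ≤ n * log n := by
    rw [← log_pow]
    exact log_le_log (by positivity) (mod_cast Nat.factorial_le_pow n)
  have h3 : ∑ p ∈ Nat.primesLE n, log p ≤ log 4 * n := by
    rw [← Chebyshev.theta_eq_sum_primesLE_log]
    exact Chebyshev.theta_le_log4_mul_x hn'.le
  have h4 : ∑ p ∈ Nat.primesLE n, ((n : ℝ) / p - 1) * log p =
      n * ∑ p ∈ Nat.primesLE n, log p / p - ∑ p ∈ Nat.primesLE n, log p := by
    rw [Finset.mul_sum, ← Finset.sum_sub_distrib]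
    exact Finset.sum_congr rfl fun p _ => by ring
  have h5 : (n : ℝ) * ∑ p ∈ Nat.primesLE n, log p / p ≤ n * (log n + log 4) := by linarith
  exact le_of_mul_le_mul_left h5 hn'

theorem summable_log_div_mul_sub_one :
    Summable fun n : ℕ => log n / ((n : ℝ) * (n - 1)) := by
  have h : Summable fun n : ℕ => 4 * (1 / (n : ℝ) ^ (3 / 2 : ℝ)) :=
    (Real.summable_one_div_nat_rpow.2 (by norm_num)).mul_left 4
  refine h.of_norm_bounded_eventually_nat ?_
  filter_upwards [eventually_ge_atTop 2] with n hn
  have hn2 : (2 : ℝ) ≤ n := mod_cast hn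
  have hn0 : (0 : ℝ) < n := by linarith
  have hpos : (0 : ℝ) < (n : ℝ) * (n - 1) := mul_pos hn0 (by linarith)
  rw [norm_of_nonneg (div_nonneg (log_natCast_nonneg n) hpos.le)]
  have hl := Real.log_le_rpow_div hn0.le (ε := 1 / 2) (by norm_num)
  rw [div_le_iff₀ hpos, mul_one_div, div_mul_eq_mul_div, le_div_iff₀ (by positivity)]
  have hr : (n : ℝ) ^ (1 / 2 : ℝ) * (n : ℝ) ^ (3 / 2 : ℝ) = (n : ℝ) ^ 2 := by
    rw [← rpow_add hn0]; norm_num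
  calc log n * (n : ℝ) ^ (3 / 2 : ℝ)
      ≤ (n : ℝ) ^ (1 / 2 : ℝ) / (1 / 2) * (n : ℝ) ^ (3 / 2 : ℝ) := by gcongr
    _ = 2 * (n : ℝ) ^ 2 := by rw [← hr]; ring
    _ ≤ 4 * (n * (n - 1)) := by nlinarith

theorem exists_log_sub_le_sum_primesLE_log_div :
    ∃ C : ℝ, ∀ n : ℕ, n ≠ 0 → log n - C ≤ ∑ p ∈ Nat.primesLE n, log p / p := by
  refine ⟨1 + ∑' n : ℕ, log n / ((n : ℝ) * (n - 1)), fun n hn => ?_⟩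
  have hn' : (0 : ℝ) < n := by positivity
  have h1 : log (n.factorial : ℝ) ≤ ∑ p ∈ Nat.primesLE n, (n : ℝ) / (p - 1) * log p := by
    rw [log_factorial_eq_sum_primesLE]
    refine Finset.sum_le_sum fun p hp => ?_
    have hp' := Nat.prime_of_mem_primesLE hp
    have hp1 : (1 : ℝ) < p := mod_cast hp'.one_lt
    have h : (p - 1) * n.factorial.factorization p ≤ n := by
      rw [Nat.sub_one_mul_factorization_factorial hp']; omega
    have h' : ((p : ℝ) - 1) * n.factorial.factorization p ≤ n := by
      have := (Nat.cast_le (α := ℝ)).2 h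
      rwa [Nat.cast_mul, Nat.cast_sub hp'.one_lt.le, Nat.cast_one] at this
    refine mul_le_mul_of_nonneg_right ?_ (log_natCast_nonneg p)
    rw [le_div_iff₀ (by linarith)]
    linarith
  have h2 : (n : ℝ) * log n - n ≤ log (n.factorial : ℝ) := by
    have := Stirling.le_log_factorial_stirling hn
    have := log_natCast_nonneg n
    have : 0 ≤ log (2 * π) := log_nonneg (by linarith [pi_gt_three])
    linarith
  have h3 : ∑ p ∈ Nat.primesLE n, (n : ℝ) / (p - 1) * log p =
      n * (∑ p ∈ Nat.primesLE n, log p / p +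
        ∑ p ∈ Nat.primesLE n, log p / ((p : ℝ) * (p - 1))) := by
    rw [← Finset.sum_add_distrib, Finset.mul_sum]
    refine Finset.sum_congr rfl fun p hp => ?_
    have hp1 : (1 : ℝ) < p := mod_cast (Nat.prime_of_mem_primesLE hp).one_lt
    have : (p : ℝ) - 1 ≠ 0 := by linarith
    field_simp
    ring
  have h4 : ∑ p ∈ Nat.primesLE n, log p / ((p : ℝ) * (p - 1)) ≤
      ∑' n : ℕ, log n / ((n : ℝ) * (n - 1)) := by
    refine summable_log_div_mul_sub_one.sum_le_tsum _ fun m _ => ?_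
    rcases m.eq_zero_or_pos with rfl | hm
    · simp
    · have : (1 : ℝ) ≤ m := mod_cast hm
      exact div_nonneg (log_natCast_nonneg m) (mul_nonneg (by linarith) (by linarith))
  rw [h3] at h1
  have h5 : (n : ℝ) * (log n - 1) ≤ n * (∑ p ∈ Nat.primesLE n, log p / p +
        ∑ p ∈ Nat.primesLE n, log p / ((p : ℝ) * (p - 1))) := by linarith
  have := le_of_mul_le_mul_left h5 hn'
  linarith

theorem sum_primesLE_succ (f : ℕ → ℝ) (n : ℕ) :
    ∑ p ∈ Nat.primesLE (n + 1), f p =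
      ∑ p ∈ Nat.primesLE n, f p + if (n + 1).Prime then f (n + 1) else 0 := by
  simp only [Nat.primesLE_eq_filter_range, Finset.sum_filter]
  exact Finset.sum_range_succ _ _

theorem summable_log_div_sub_loglog :
    Summable fun i : ℕ => (log (i + 3 : ℝ) - log (i + 2 : ℝ)) / log (i + 3 : ℝ) -
      (log (log (i + 3 : ℝ)) - log (log (i + 2 : ℝ))) := by
  rw [← summable_neg_iff]
  have hb (i : ℕ) : 0 < log (i + 2 : ℝ) := log_pos (by linarith [i.cast_nonneg (α := ℝ)])
  have hab (i : ℕ) : log (i + 2 : ℝ) ≤ log (i + 3 : ℝ) :=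
    log_le_log (by positivity) (by linarith)
  have hδ (i : ℕ) : log (i + 3 : ℝ) - log (i + 2 : ℝ) ≤ 1 := by
    rw [← log_div (by positivity) (by positivity)]
    refine (log_le_sub_one_of_pos (by positivity)).trans ?_
    rw [sub_le_iff_le_add, div_le_iff₀ (by positivity)]
    linarith [i.cast_nonneg (α := ℝ)]
  refine summable_of_sum_range_le (c := 1 / log 2) (fun i => ?_) fun n => ?_
  · have ha := (hb i).trans_le (hab i)
    have := one_sub_inv_le_log_of_pos (div_pos ha (hb i))
    rw [log_div ha.ne' (hb i).ne', inv_div] at this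
    rw [sub_div, div_self ha.ne']
    linarith
  · have key : ∀ i ∈ Finset.range n,
        -((log (i + 3 : ℝ) - log (i + 2 : ℝ)) / log (i + 3 : ℝ) -
          (log (log (i + 3 : ℝ)) - log (log (i + 2 : ℝ)))) ≤
        1 / log ((i : ℕ) + 2 : ℝ) - 1 / log ((i + 1 : ℕ) + 2 : ℝ) := by
      intro i _
      have ha := (hb i).trans_le (hab i)
      have h1 := log_le_sub_one_of_pos (div_pos ha (hb i))
      rw [log_div ha.ne' (hb i).ne'] at h1
      have h2 : ((i + 1 : ℕ) + 2 : ℝ) = i + 3 := by push_cast; ring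
      rw [h2]
      have h3 : 0 ≤ 1 / log (i + 2 : ℝ) - 1 / log (i + 3 : ℝ) :=
        sub_nonneg.2 (one_div_le_one_div_of_le (hb i) (hab i))
      have h4 := mul_le_mul_of_nonneg_right (hδ i) h3
      have h5 : (log (i + 3 : ℝ) - log (i + 2 : ℝ)) *
          (1 / log (i + 2 : ℝ) - 1 / log (i + 3 : ℝ)) =
          log (i + 3 : ℝ) / log (i + 2 : ℝ) - 1 -
            (log (i + 3 : ℝ) - log (i + 2 : ℝ)) / log (i + 3 : ℝ) := by
        have := (hb i).ne'
        field_simp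
      linarith
    refine (Finset.sum_le_sum key).trans ?_
    rw [Finset.sum_range_sub' (fun i : ℕ => 1 / log (i + 2 : ℝ))]
    have := one_div_pos.2 (hb n)
    norm_num at this ⊢
    linarith

/-- **Mertens' second theorem**, with an unspecified constant. -/
theorem exists_tendsto_sum_primesLE_one_div_sub_loglog :
    ∃ M : ℝ, Tendsto (fun n : ℕ => ∑ p ∈ Nat.primesLE n, 1 / (p : ℝ) - log (log n))
      atTop (𝓝 M) := by
  obtain ⟨C, hC⟩ := exists_log_sub_le_sum_primesLE_log_div
  set S : ℕ → ℝ := fun n => ∑ p ∈ Nat.primesLE n, log p / p with hS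
  set u : ℕ → ℝ := fun i => S (i + 2) - log ((i + 2 : ℕ) : ℝ) with hu
  set g : ℕ → ℝ := fun i => 1 / log (i + 3 : ℝ) with hg
  have hlog (i : ℕ) : 0 < log (i + 3 : ℝ) := log_pos (by linarith [i.cast_nonneg (α := ℝ)])
  have hubd (i : ℕ) : |u i| ≤ |C| + log 4 := by
    have h1 := sum_primesLE_log_div_le (n := i + 2) (by omega)
    have h2 := hC (i + 2) (by omega)
    have h4 : 0 ≤ log 4 := log_nonneg (by norm_num)
    have := le_abs_self C
    have := abs_nonneg C
    simp only [hu, hS]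
    rw [abs_le]
    constructor <;> linarith
  have hganti : Antitone g := fun i j hij => by
    have : (i : ℝ) ≤ j := mod_cast hij
    exact one_div_le_one_div_of_le (hlog i) (log_le_log (by positivity) (by linarith))
  have hg0 : Tendsto g atTop (𝓝 0) := by
    simp only [hg, one_div]
    exact tendsto_inv_atTop_zero.comp (tendsto_log_atTop.comp
      (tendsto_atTop_add_const_right _ _ tendsto_natCast_atTop_atTop))
  have hcau := hganti.cauchySeq_series_mul_of_tendsto_zero_of_bounded hg0
    (z := fun i => u (i + 1) - u i) (b := 2 * (|C| + log 4)) (fun n => by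
      rw [Finset.sum_range_sub, norm_eq_abs]
      have := abs_sub (u n) (u 0)
      linarith [hubd n, hubd 0])
  obtain ⟨L, hL⟩ := cauchySeq_tendsto_of_complete hcau
  have he := summable_log_div_sub_loglog.hasSum.tendsto_sum_nat
  set Q : ℕ → ℝ := fun i => ∑ p ∈ Nat.primesLE (i + 2), 1 / (p : ℝ) - log (log ((i + 2 : ℕ) : ℝ))
    with hQ
  have hstep (i : ℕ) : Q (i + 1) - Q i = g i • (u (i + 1) - u i) +
      ((log (i + 3 : ℝ) - log (i + 2 : ℝ)) / log (i + 3 : ℝ) -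
        (log (log (i + 3 : ℝ)) - log (log (i + 2 : ℝ)))) := by
    have hl := (hlog i).ne'
    have e3 : ((i + 1 + 2 : ℕ) : ℝ) = i + 3 := by push_cast; ring
    have e2 : ((i + 2 : ℕ) : ℝ) = i + 2 := by push_cast; ring
    have p1 := sum_primesLE_succ (fun p => 1 / (p : ℝ)) (i + 2)
    have p2 := sum_primesLE_succ (fun p => log p / (p : ℝ)) (i + 2)
    simp only [hQ, hu, hS, hg, smul_eq_mul]
    rw [show i + 1 + 2 = i + 2 + 1 by ring] at e3 ⊢
    rw [p1, p2, e3, e2]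
    split_ifs
    · field_simp
      ring
    · field_simp
      ring
  have hsum (n : ℕ) : Q n = Q 0 + (∑ i ∈ Finset.range n, g i • (u (i + 1) - u i) +
      ∑ i ∈ Finset.range n, ((log (i + 3 : ℝ) - log (i + 2 : ℝ)) / log (i + 3 : ℝ) -
        (log (log (i + 3 : ℝ)) - log (log (i + 2 : ℝ))))) := by
    rw [← Finset.sum_add_distrib, ← Finset.sum_congr rfl fun i _ => hstep i,
      Finset.sum_range_sub]
    ring
  have hQlim := (hL.add he).const_add (Q 0)
  rw [← funext hsum] at hQlim
  exact ⟨_, (tendsto_add_atTop_iff_nat 2).1 hQlim⟩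

theorem tendsto_loglog_sub_loglog_floor :
    Tendsto (fun x : ℝ => log (log x) - log (log ⌊x⌋₊)) atTop (𝓝 0) := by
  have hfl : Tendsto (fun x : ℝ => log (⌊x⌋₊ : ℝ)) atTop atTop :=
    tendsto_log_atTop.comp (tendsto_natCast_atTop_atTop.comp tendsto_nat_floor_atTop)
  refine squeeze_zero' (g := fun x : ℝ => log 2 / log ⌊x⌋₊) ?_ ?_ (hfl.const_div_atTop _)
  · filter_upwards [eventually_ge_atTop 2] with x hx
    have hf : (2 : ℝ) ≤ ⌊x⌋₊ := mod_cast Nat.le_floor (by exact_mod_cast hx)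
    have h1 := Nat.floor_le (a := x) (by linarith)
    have h2 : 0 < log (⌊x⌋₊ : ℝ) := log_pos (by linarith)
    exact sub_nonneg.2 (log_le_log h2 (log_le_log (by linarith) h1))
  · filter_upwards [eventually_ge_atTop 2] with x hx
    have hf : (2 : ℝ) ≤ ⌊x⌋₊ := mod_cast Nat.le_floor (by exact_mod_cast hx)
    have h1 := Nat.lt_floor_add_one x
    have h2 : 0 < log (⌊x⌋₊ : ℝ) := log_pos (by linarith)
    have h3 : 0 < log x := log_pos (by linarith)
    have h4 : log x ≤ log 2 + log ⌊x⌋₊ := by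
      rw [← log_mul (by norm_num) (by linarith)]
      exact log_le_log (by linarith) (by linarith)
    rw [← log_div h3.ne' h2.ne']
    refine (log_le_sub_one_of_pos (div_pos h3 h2)).trans ?_
    rw [sub_le_iff_le_add, div_add_one h2.ne']
    gcongr

theorem tendsto_sum_primesLE_floor_sub_loglog {f : ℕ → ℝ} {M : ℝ}
    (h : Tendsto (fun n : ℕ => ∑ p ∈ Nat.primesLE n, f p - log (log n)) atTop (𝓝 M)) :
    Tendsto (fun x : ℝ => ∑ p ∈ Nat.primesLE ⌊x⌋₊, f p - log (log x)) atTop (𝓝 M) := by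
  have := (h.comp tendsto_nat_floor_atTop).sub tendsto_loglog_sub_loglog_floor
  rw [sub_zero] at this
  refine this.congr fun x => ?_
  simp only [Function.comp_apply]
  ring

theorem exists_abs_sum_primesLE_exp_sub_log_le {M : ℝ}
    (h : Tendsto (fun n : ℕ => ∑ p ∈ Nat.primesLE n, 1 / (p : ℝ) - log (log n)) atTop (𝓝 M)) :
    ∃ C : ℝ, ∀ s u : ℝ, 0 < s → s ≤ 1 → 0 < u →
      |∑ p ∈ Nat.primesLE ⌊exp (u / s)⌋₊, 1 / (p : ℝ) - log (u / s)| ≤ C + |log u| := by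
  have h1 := ((tendsto_sum_primesLE_floor_sub_loglog h).comp tendsto_exp_atTop).abs
  have h2 := h1.eventually (eventually_le_nhds (lt_add_one |M|))
  obtain ⟨V, hV'⟩ := (h2.and (eventually_ge_atTop (1 : ℝ))).exists_forall_of_atTop
  have hV1 : 1 ≤ V := (hV' V le_rfl).2
  set B := ∑ p ∈ Nat.primesLE ⌊exp V⌋₊, 1 / (p : ℝ) with hB
  have hB0 : 0 ≤ B := Finset.sum_nonneg fun p _ => by positivity
  have hlV : 0 ≤ log V := log_nonneg hV1
  refine ⟨|M| + 1 + B + log V, fun s u hs hs1 hu => ?_⟩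
  have hM := abs_nonneg M
  have hlu := abs_nonneg (log u)
  rcases le_total V (u / s) with hv | hv
  · have := (hV' _ hv).1
    simp only [Function.comp_apply, log_exp] at this
    linarith
  · have hus : 0 < u / s := div_pos hu hs
    have hP : ∑ p ∈ Nat.primesLE ⌊exp (u / s)⌋₊, 1 / (p : ℝ) ≤ B :=
      Finset.sum_le_sum_of_subset_of_nonneg
        (Nat.primesLE_mono (Nat.floor_mono (exp_le_exp.2 hv))) fun p _ _ => by positivity
    have hP0 : 0 ≤ ∑ p ∈ Nat.primesLE ⌊exp (u / s)⌋₊, 1 / (p : ℝ) :=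
      Finset.sum_nonneg fun p _ => by positivity
    have hl1 : log (u / s) ≤ log V := log_le_log hus hv
    have hl2 : log u ≤ log (u / s) := log_le_log hu (by rw [le_div_iff₀ hs]; nlinarith)
    have := neg_abs_le (log u)
    rw [abs_le]
    constructor <;> linarith

open MeasureTheory in
theorem integrableOn_exp_neg_mul_abs_log :
    IntegrableOn (fun u : ℝ => exp (-u) * |log u|) (Set.Ioi 0) := by
  have h1 := Real.GammaIntegral_convergent (s := 1 / 2) (by norm_num)
  have h2 := Real.GammaIntegral_convergent (s := 3 / 2) (by norm_num)
  refine ((h1.add h2).const_mul 2).mono' ?_ ?_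
  · exact (Measurable.aestronglyMeasurable (by fun_prop))
  · filter_upwards [ae_restrict_mem measurableSet_Ioi] with u hu
    have hu0 : (0 : ℝ) < u := hu
    rw [norm_of_nonneg (by positivity)]
    have hl : |log u| ≤ 2 * (u ^ (1 / 2 - 1 : ℝ) + u ^ (3 / 2 - 1 : ℝ)) := by
      have a1 := Real.log_le_rpow_div hu0.le (ε := 1 / 2) (by norm_num)
      have a2 := Real.log_le_rpow_div (inv_nonneg.2 hu0.le) (ε := 1 / 2) (by norm_num)
      rw [log_inv, inv_rpow hu0.le, ← rpow_neg hu0.le] at a2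
      norm_num at a1 a2 ⊢
      have b1 : 0 < u ^ (1 / 2 : ℝ) := by positivity
      have b2 : 0 < u ^ (-(1 / 2) : ℝ) := by positivity
      rw [abs_le]
      constructor <;> linarith
    calc exp (-u) * |log u|
        ≤ exp (-u) * (2 * (u ^ (1 / 2 - 1 : ℝ) + u ^ (3 / 2 - 1 : ℝ))) := by gcongr
      _ = _ := by simp only [Pi.add_apply]; ring

open MeasureTheory in
theorem integral_exp_neg_mul_log :
    ∫ u in Set.Ioi (0 : ℝ), exp (-u) * log u = -eulerMascheroniConstant := by
  have h := Complex.hasDerivAt_GammaIntegral (s := 1) (by simp)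
  have h' : HasDerivAt Complex.Gamma
      (∫ t : ℝ in Set.Ioi 0, (t : ℂ) ^ ((1 : ℂ) - 1) * (Real.log t * Real.exp (-t))) 1 := by
    refine h.congr_of_eventuallyEq ?_
    have : IsOpen {z : ℂ | 0 < z.re} := isOpen_lt continuous_const Complex.continuous_re
    filter_upwards [this.mem_nhds (by simp : (1 : ℂ) ∈ {z : ℂ | 0 < z.re})] with a ha
    exact Complex.Gamma_eq_integral ha
  have h2 := h'.unique Complex.hasDerivAt_Gamma_one
  have h3 : ((∫ u in Set.Ioi (0 : ℝ), exp (-u) * log u : ℝ) : ℂ) =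
      ((-eulerMascheroniConstant : ℝ) : ℂ) := by
    rw [← integral_complex_ofReal, Complex.ofReal_neg, ← h2]
    congr 1 with t
    simp [mul_comm]
  exact_mod_cast h3

open MeasureTheory in
theorem hasSum_primes_rpow_eq_integral {s : ℝ} (hs : 0 < s) :
    HasSum (fun n : ℕ => if n.Prime then 1 / (n : ℝ) ^ (1 + s) else 0)
      (∫ u in Set.Ioi (0 : ℝ),
        exp (-u) * ∑ p ∈ Nat.primesLE ⌊exp (u / s)⌋₊, 1 / (p : ℝ)) := by
  set F : ℕ → ℝ → ℝ := fun n u =>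
    if n.Prime then (1 / (n : ℝ)) * (Set.Ici (s * log n)).indicator (fun u => exp (-u)) u else 0
    with hF
  have hpos (n : ℕ) (u : ℝ) : 0 ≤ F n u := by
    simp only [hF]
    split_ifs
    · exact mul_nonneg (by positivity) (Set.indicator_nonneg (fun _ _ => (exp_pos _).le) _)
    · rfl
  have hFint (n : ℕ) : IntegrableOn (F n) (Set.Ioi 0) := by
    by_cases hn : n.Prime
    · simp only [hF, hn, if_true]
      have h1 : IntegrableOn (fun u => exp (-u)) (Set.Ioi 0) := integrableOn_exp_neg_Ioi 0
      exact (h1.indicator measurableSet_Ici).const_mul _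
    · simp only [hF, hn, if_false]
      exact integrable_zero _ _ _
  have hval (n : ℕ) : ∫ u in Set.Ioi (0 : ℝ), F n u =
      if n.Prime then 1 / (n : ℝ) ^ (1 + s) else 0 := by
    by_cases hn : n.Prime
    · have hn1 : (1 : ℝ) < n := mod_cast hn.one_lt
      have hn0 : (0 : ℝ) < n := by linarith
      have hl : 0 < s * log n := mul_pos hs (log_pos hn1)
      simp only [hF, hn, if_true]
      rw [integral_const_mul, setIntegral_indicator measurableSet_Ici,
        Set.inter_eq_self_of_subset_right (Set.Ici_subset_Ioi.2 hl),
        integral_Ici_eq_integral_Ioi, integral_exp_neg_Ioi, rpow_add hn0, rpow_one,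
        rpow_def_of_pos hn0, exp_neg, mul_comm s]
      field_simp
    · simp [hF, hn]
  have hsummable : Summable fun n => ∫ u in Set.Ioi (0 : ℝ), ‖F n u‖ := by
    simp only [fun n u => norm_of_nonneg (hpos n u), hval]
    refine (Real.summable_one_div_nat_rpow.2 (by linarith : 1 < 1 + s)).of_nonneg_of_le
      (fun n => ?_) fun n => ?_
    · split_ifs <;> positivity
    · split_ifs
      · rfl
      · positivity
  have key := hasSum_integral_of_summable_integral_norm hFint hsummable
  simp only [hval] at key
  have hfun (u : ℝ) : ∑' n, F n u =
      exp (-u) * ∑ p ∈ Nat.primesLE ⌊exp (u / s)⌋₊, 1 / (p : ℝ) := by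
    rw [tsum_eq_sum (s := Nat.primesLE ⌊exp (u / s)⌋₊), Finset.mul_sum]
    · refine Finset.sum_congr rfl fun p hp => ?_
      obtain ⟨hle, hp'⟩ := Nat.mem_primesLE.1 hp
      have hp0 : (0 : ℝ) < p := mod_cast hp'.pos
      have h1 : (p : ℝ) ≤ exp (u / s) := (Nat.le_floor_iff (exp_pos _).le).1 hle
      have h2 : s * log p ≤ u := by
        rw [mul_comm, ← le_div_iff₀ hs]
        exact (log_le_iff_le_exp hp0).2 h1
      simp only [hF, hp', if_true]
      rw [Set.indicator_of_mem (Set.mem_Ici.2 h2), mul_comm]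
    · intro p hp
      by_cases hp' : p.Prime
      · have hp0 : (0 : ℝ) < p := mod_cast hp'.pos
        simp only [hF, hp', if_true]
        rw [Set.indicator_of_notMem, mul_zero]
        intro hmem
        refine hp (Nat.mem_primesLE.2 ⟨Nat.le_floor ?_, hp'⟩)
        rw [← log_le_iff_le_exp hp0, le_div_iff₀ hs, mul_comm]
        exact hmem
      · simp [hF, hp']
  simpa only [hfun] using key

open MeasureTheory in
theorem tendsto_tsum_primes_rpow_add_log {M : ℝ}
    (h : Tendsto (fun n : ℕ => ∑ p ∈ Nat.primesLE n, 1 / (p : ℝ) - log (log n)) atTop (𝓝 M)) :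
    Tendsto (fun s : ℝ => ∑' n : ℕ, (if n.Prime then 1 / (n : ℝ) ^ (1 + s) else 0) + log s)
      (𝓝[>] 0) (𝓝 (M - eulerMascheroniConstant)) := by
  obtain ⟨C, hC⟩ := exists_abs_sum_primesLE_exp_sub_log_le h
  set G : ℝ → ℝ → ℝ := fun s u =>
    exp (-u) * (∑ p ∈ Nat.primesLE ⌊exp (u / s)⌋₊, 1 / (p : ℝ) - log (u / s)) with hG
  have hexp : IntegrableOn (fun u : ℝ => exp (-u)) (Set.Ioi 0) := integrableOn_exp_neg_Ioi 0
  have hbound : IntegrableOn (fun u : ℝ => exp (-u) * (C + |log u|)) (Set.Ioi 0) := by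
    simp only [mul_add]
    exact (hexp.mul_const C).add integrableOn_exp_neg_mul_abs_log
  have hmeas (s : ℝ) : Measurable (G s) := by
    have : Measurable fun u : ℝ => ∑ p ∈ Nat.primesLE ⌊exp (u / s)⌋₊, 1 / (p : ℝ) :=
      (measurable_from_nat (f := fun n => ∑ p ∈ Nat.primesLE n, 1 / (p : ℝ))).comp
        (Nat.measurable_floor.comp (by fun_prop))
    fun_prop
  have hle (s : ℝ) (hs : 0 < s) (hs1 : s ≤ 1) :
      ∀ᵐ u ∂volume.restrict (Set.Ioi 0), ‖G s u‖ ≤ exp (-u) * (C + |log u|) := by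
    filter_upwards [ae_restrict_mem measurableSet_Ioi] with u hu
    rw [norm_mul, norm_of_nonneg (exp_pos _).le, norm_eq_abs]
    exact mul_le_mul_of_nonneg_left (hC s u hs hs1 hu) (exp_pos _).le
  have hlogint : IntegrableOn (fun u : ℝ => exp (-u) * log u) (Set.Ioi 0) :=
    integrableOn_exp_neg_mul_abs_log.mono' (Measurable.aestronglyMeasurable (by fun_prop))
      (ae_of_all _ fun u => by rw [norm_mul, norm_of_nonneg (exp_pos _).le, norm_eq_abs])
  have hsmall : ∀ᶠ s : ℝ in 𝓝[>] 0, 0 < s ∧ s ≤ 1 := by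
    filter_upwards [Ioc_mem_nhdsGT (zero_lt_one' ℝ)] with s hs using hs
  have hlim : Tendsto (fun s => ∫ u in Set.Ioi (0 : ℝ), G s u) (𝓝[>] 0)
      (𝓝 (∫ u in Set.Ioi (0 : ℝ), exp (-u) * M)) := by
    refine tendsto_integral_filter_of_dominated_convergence _
      (Eventually.of_forall fun s => (hmeas s).aestronglyMeasurable)
      (hsmall.mono fun s hs => hle s hs.1 hs.2) hbound ?_
    filter_upwards [ae_restrict_mem measurableSet_Ioi] with u hu
    have h1 : Tendsto (fun s : ℝ => u / s) (𝓝[>] 0) atTop := by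
      simp only [div_eq_mul_inv]
      exact tendsto_inv_nhdsGT_zero.const_mul_atTop hu
    have h2 := (tendsto_sum_primesLE_floor_sub_loglog h).comp (tendsto_exp_atTop.comp h1)
    refine Tendsto.const_mul _ (h2.congr fun s => ?_)
    simp only [Function.comp_apply, log_exp]
  rw [integral_mul_const, integral_exp_neg_Ioi_zero, one_mul] at hlim
  refine (hlim.sub_const eulerMascheroniConstant).congr' ?_
  filter_upwards [hsmall] with s ⟨hs, hs1⟩
  have hGint : IntegrableOn (G s) (Set.Ioi 0) :=
    hbound.mono' (hmeas s).aestronglyMeasurable (hle s hs hs1)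
  have hsplit : ∫ u in Set.Ioi (0 : ℝ),
        exp (-u) * ∑ p ∈ Nat.primesLE ⌊exp (u / s)⌋₊, 1 / (p : ℝ) =
      ∫ u in Set.Ioi (0 : ℝ), (G s u + (exp (-u) * log u - exp (-u) * log s)) := by
    refine setIntegral_congr_fun measurableSet_Ioi fun u hu => ?_
    simp only [hG]
    rw [log_div (ne_of_gt hu) hs.ne']
    ring
  have hdiff : IntegrableOn (fun u : ℝ => exp (-u) * log u - exp (-u) * log s) (Set.Ioi 0) :=
    hlogint.sub (hexp.mul_const _)
  rw [(hasSum_primes_rpow_eq_integral hs).tsum_eq, hsplit, integral_add hGint hdiff,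
    integral_sub hlogint (hexp.mul_const _), integral_exp_neg_mul_log, integral_mul_const,
    integral_exp_neg_Ioi_zero]
  ring

theorem abs_neg_log_one_sub_sub_le {y : ℝ} (h0 : 0 ≤ y) (h1 : y ≤ 1 / 2) :
    |-log (1 - y) - y| ≤ 2 * y ^ 2 := by
  have h := abs_log_sub_add_sum_range_le (x := y) (by rw [abs_of_nonneg h0]; linarith) 1
  simp only [Finset.sum_range_one, abs_of_nonneg h0] at h
  norm_num at h
  rw [← abs_neg, show -(-log (1 - y) - y) = y + log (1 - y) by ring]
  refine h.trans ?_
  rw [div_le_iff₀ (by linarith)]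
  nlinarith [sq_nonneg y]

theorem one_div_rpow_one_add_le {n : ℕ} (hn : n.Prime) {s : ℝ} (hs : 0 ≤ s) :
    1 / (n : ℝ) ^ (1 + s) ≤ 1 / n := by
  have hn1 : (1 : ℝ) ≤ n := mod_cast hn.one_lt.le
  refine one_div_le_one_div_of_le (by linarith) ?_
  simpa using rpow_le_rpow_of_exponent_le hn1 (by linarith : 1 ≤ 1 + s)

theorem Nat.Prime.one_div_le_half {n : ℕ} (hn : n.Prime) : 1 / (n : ℝ) ≤ 1 / 2 :=
  one_div_le_one_div_of_le (by norm_num) (mod_cast hn.two_le)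

/-- The summand of `∑ p, (-log (1 - p⁻¹⁻ˢ) - p⁻¹⁻ˢ)`, indexed by all natural numbers. -/
noncomputable def eulerLogError (s : ℝ) (n : ℕ) : ℝ :=
  if n.Prime then -log (1 - 1 / (n : ℝ) ^ (1 + s)) - 1 / (n : ℝ) ^ (1 + s) else 0

theorem norm_eulerLogError_le {s : ℝ} (hs : 0 ≤ s) (n : ℕ) :
    ‖eulerLogError s n‖ ≤ 2 * (1 / (n : ℝ) ^ 2) := by
  unfold eulerLogError
  split_ifs with hn
  · have h := one_div_rpow_one_add_le hn hs
    have h0 : 0 ≤ 1 / (n : ℝ) ^ (1 + s) := by positivity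
    refine (abs_neg_log_one_sub_sub_le h0 (h.trans hn.one_div_le_half)).trans ?_
    rw [← one_div_pow]
    gcongr
  · rw [norm_zero]
    positivity

theorem summable_two_mul_one_div_sq : Summable fun n : ℕ => 2 * (1 / (n : ℝ) ^ 2) :=
  (Real.summable_one_div_nat_pow.2 one_lt_two).mul_left 2

theorem summable_eulerLogError {s : ℝ} (hs : 0 ≤ s) : Summable (eulerLogError s) :=
  summable_two_mul_one_div_sq.of_norm_bounded (norm_eulerLogError_le hs)

theorem tendsto_tsum_eulerLogError :
    Tendsto (fun s => ∑' n, eulerLogError s n) (𝓝[>] 0) (𝓝 (∑' n, eulerLogError 0 n)) := by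
  refine tendsto_tsum_of_dominated_convergence summable_two_mul_one_div_sq (fun n => ?_) ?_
  · unfold eulerLogError
    split_ifs with hn
    · have hn0 : (n : ℝ) ≠ 0 := mod_cast hn.ne_zero
      have hlt : 1 / (n : ℝ) ^ (1 + (0 : ℝ)) < 1 := by
        have := (one_div_rpow_one_add_le hn le_rfl).trans hn.one_div_le_half
        linarith
      have hc : ContinuousAt (fun s : ℝ => 1 / (n : ℝ) ^ (1 + s)) 0 := by
        refine ContinuousAt.div continuousAt_const ?_ (by simpa using hn0)
        exact ContinuousAt.rpow continuousAt_const (by fun_prop) (Or.inl hn0)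
      have : ContinuousAt
          (fun s : ℝ => -log (1 - 1 / (n : ℝ) ^ (1 + s)) - 1 / (n : ℝ) ^ (1 + s)) 0 :=
        ((continuousAt_const.sub hc).log (sub_pos.2 hlt).ne').neg.sub hc
      exact this.tendsto.mono_left nhdsWithin_le_nhds
    · exact tendsto_const_nhds
  · filter_upwards [self_mem_nhdsWithin] with s hs n
    exact norm_eulerLogError_le (le_of_lt hs) n

theorem tsum_primes_rpow_add_tsum_eulerLogError {s : ℝ} (hs : 0 < s) :
    ∑' n : ℕ, (if n.Prime then 1 / (n : ℝ) ^ (1 + s) else 0) + ∑' n, eulerLogError s n =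
      log (∑' n : ℕ, 1 / (n : ℝ) ^ (1 + s)) := by
  have hsum := Real.summable_one_div_nat_rpow.2 (by linarith : 1 < 1 + s)
  let f : ℕ →*₀ ℝ :=
    { toFun := fun n => 1 / (n : ℝ) ^ (1 + s)
      map_zero' := by rw [Nat.cast_zero, zero_rpow (by linarith), div_zero]
      map_one' := by simp
      map_mul' := fun m n => by
        rw [Nat.cast_mul, mul_rpow (by positivity) (by positivity), one_div_mul_one_div] }
  have hf (n : ℕ) : f n = 1 / (n : ℝ) ^ (1 + s) := rfl
  have hprod := EulerProduct.eulerProduct_completely_multiplicative (f := f) hsum.norm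
  simp only [hf] at hprod
  have hpos : 0 < ∑' n : ℕ, 1 / (n : ℝ) ^ (1 + s) :=
    hsum.tsum_pos (fun n => by positivity) 1 (by simp)
  have hlim := ((hasSum_primes_rpow_eq_integral hs).summable.hasSum.add
    (summable_eulerLogError hs.le).hasSum).tendsto_sum_nat
  refine tendsto_nhds_unique hlim ((hprod.log hpos.ne').congr fun n => ?_)
  have hlt {p : ℕ} (hp : p.Prime) : 0 < 1 - 1 / (p : ℝ) ^ (1 + s) := by
    have := (one_div_rpow_one_add_le hp hs.le).trans hp.one_div_le_half
    linarith
  rw [log_prod fun p hp => (inv_pos.2 (hlt (Nat.prime_of_mem_primesBelow hp))).ne',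
    Nat.primesBelow, Finset.sum_filter]
  refine Finset.sum_congr rfl fun p _ => ?_
  unfold eulerLogError
  split_ifs
  · rw [log_inv]; ring
  · rw [add_zero]

theorem add_tsum_eulerLogError_zero {M : ℝ}
    (h : Tendsto (fun n : ℕ => ∑ p ∈ Nat.primesLE n, 1 / (p : ℝ) - log (log n)) atTop (𝓝 M)) :
    M + ∑' n, eulerLogError 0 n = eulerMascheroniConstant := by
  have h1 := (tendsto_tsum_primes_rpow_add_log h).add tendsto_tsum_eulerLogError
  have hshift : Tendsto (fun s : ℝ => 1 + s) (𝓝[>] 0) (𝓝[>] 1) := by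
    refine tendsto_nhdsWithin_iff.2 ⟨?_, ?_⟩
    · exact ((continuous_const.add continuous_id).tendsto' (0 : ℝ) 1 (by simp)).mono_left
        nhdsWithin_le_nhds
    · filter_upwards [self_mem_nhdsWithin] with s hs
      have : (0 : ℝ) < s := hs
      simpa using this
  have h2 := (tendsto_sub_mul_tsum_nat_rpow.comp hshift).log one_ne_zero
  rw [log_one] at h2
  have h3 := tendsto_nhds_unique_of_eventuallyEq h1 h2 (by
    filter_upwards [self_mem_nhdsWithin] with s hs
    have hs0 : (0 : ℝ) < s := hs
    have hsum := Real.summable_one_div_nat_rpow.2 (by linarith : 1 < 1 + s)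
    have hpos : 0 < ∑' n : ℕ, 1 / (n : ℝ) ^ (1 + s) :=
      hsum.tsum_pos (fun n => by positivity) 1 (by simp)
    simp only [Function.comp_apply]
    rw [add_sub_cancel_left, log_mul hs0.ne' hpos.ne',
      ← tsum_primes_rpow_add_tsum_eulerLogError hs0]
    ring)
  linarith

/-- **Mertens' third theorem**. -/
theorem tendsto_prod_primesLE_one_sub_mul_log :
    Tendsto (fun x : ℝ => (∏ p ∈ Nat.primesLE ⌊x⌋₊, (1 - 1 / (p : ℝ))) * log x) atTop
      (𝓝 (exp (-eulerMascheroniConstant))) := by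
  obtain ⟨M, hM⟩ := exists_tendsto_sum_primesLE_one_div_sub_loglog
  have h1 := (summable_eulerLogError le_rfl).hasSum.tendsto_sum_nat.comp (tendsto_add_atTop_nat 1)
  have h2 := hM.add h1
  rw [add_tsum_eulerLogError_zero hM] at h2
  have h3 : Tendsto (fun n : ℕ => ∑ p ∈ Nat.primesLE n, -log (1 - 1 / (p : ℝ)) - log (log n))
      atTop (𝓝 eulerMascheroniConstant) := by
    refine h2.congr fun n => ?_
    have : ∑ p ∈ Finset.range (n + 1), eulerLogError 0 p =
        ∑ p ∈ Nat.primesLE n, (-log (1 - 1 / (p : ℝ)) - 1 / p) := by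
      rw [Nat.primesLE_eq_filter_range, Finset.sum_filter]
      exact Finset.sum_congr rfl fun p _ => by simp [eulerLogError]
    simp only [Function.comp_apply]
    rw [this, Finset.sum_sub_distrib]
    ring
  have h4 := (tendsto_sum_primesLE_floor_sub_loglog (f := fun p => -log (1 - 1 / (p : ℝ))) h3).neg
  refine (continuous_exp.continuousAt.tendsto.comp h4).congr' ?_
  filter_upwards [eventually_gt_atTop 1] with x hx
  have hpos : ∀ p ∈ Nat.primesLE ⌊x⌋₊, 0 < 1 - 1 / (p : ℝ) := fun p hp => by
    linarith [(Nat.prime_of_mem_primesLE hp).one_div_le_half]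
  simp only [Function.comp_apply]
  rw [Finset.sum_neg_distrib, neg_sub, sub_neg_eq_add, exp_add, exp_log (log_pos hx),
    ← log_prod fun p hp => (hpos p hp).ne', exp_log (Finset.prod_pos hpos), mul_comm]

theorem totient_div_self_eq_prod {n : ℕ} (hn : n ≠ 0) :
    (n.totient : ℝ) / n = ∏ p ∈ n.primeFactors, (1 - 1 / (p : ℝ)) := by
  have h := congrArg (Rat.cast : ℚ → ℝ) (Nat.totient_eq_mul_prod_factors n)
  push_cast at h
  have hn' : (n : ℝ) ≠ 0 := mod_cast hn
  rw [h, mul_div_cancel_left₀ _ hn']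
  simp only [one_div]

theorem card_primeFactors_gt_mul_log_le {n : ℕ} (hn : n ≠ 0) {L : ℝ} (hL : 0 < L) :
    ((n.primeFactors.filter fun p : ℕ => ¬(p : ℝ) ≤ L).card : ℝ) * log L ≤ log n := by
  set B := n.primeFactors.filter fun p : ℕ => ¬(p : ℝ) ≤ L with hB
  have hmem {p : ℕ} (hp : p ∈ B) : p.Prime ∧ L < p := by
    rw [hB, Finset.mem_filter, not_le] at hp
    exact ⟨Nat.prime_of_mem_primeFactors hp.1, hp.2⟩
  calc (B.card : ℝ) * log L = ∑ p ∈ B, log L := by rw [Finset.sum_const, nsmul_eq_mul]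
    _ ≤ ∑ p ∈ B, log p := Finset.sum_le_sum fun p hp => log_le_log hL (hmem hp).2.le
    _ ≤ ∑ p ∈ n.primeFactors, log p :=
      Finset.sum_le_sum_of_subset_of_nonneg (Finset.filter_subset _ _)
        fun p _ _ => log_natCast_nonneg p
    _ = log ((∏ p ∈ n.primeFactors, p : ℕ) : ℝ) := by
      rw [Nat.cast_prod, log_prod]
      exact fun p hp => mod_cast (Nat.prime_of_mem_primeFactors hp).ne_zero
    _ ≤ log n := by
      refine log_le_log (mod_cast Finset.prod_pos fun p hp =>
        (Nat.prime_of_mem_primeFactors hp).pos) ?_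
      exact_mod_cast Nat.le_of_dvd (Nat.pos_of_ne_zero hn) (Nat.prod_primeFactors_dvd n)

theorem prod_primesLE_mul_le_totient_div_self {n : ℕ} (hn : n ≠ 0) (hL : 1 < log (n : ℝ)) :
    (∏ p ∈ Nat.primesLE ⌊log (n : ℝ)⌋₊, (1 - 1 / (p : ℝ))) * (1 - 1 / log (log n)) ≤
      (n.totient : ℝ) / n := by
  set L := log (n : ℝ) with hLdef
  have hL0 : 0 < L := by linarith
  have hlogL : 0 < log L := log_pos hL
  have hfac {p : ℕ} (hp : p.Prime) : 0 ≤ 1 - 1 / (p : ℝ) ∧ 1 - 1 / (p : ℝ) ≤ 1 := by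
    have := hp.one_div_le_half
    have : 0 ≤ 1 / (p : ℝ) := by positivity
    constructor <;> linarith
  rw [totient_div_self_eq_prod hn,
    ← Finset.prod_filter_mul_prod_filter_not n.primeFactors (fun p : ℕ => (p : ℝ) ≤ L)]
  set A := n.primeFactors.filter fun p : ℕ => (p : ℝ) ≤ L with hA
  set B := n.primeFactors.filter fun p : ℕ => ¬(p : ℝ) ≤ L with hB
  have hAprime {p : ℕ} (hp : p ∈ A) : p.Prime :=
    Nat.prime_of_mem_primeFactors (Finset.mem_filter.1 hp).1
  have hsub : A ⊆ Nat.primesLE ⌊L⌋₊ := fun p hp =>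
    Nat.mem_primesLE.2 ⟨Nat.le_floor (Finset.mem_filter.1 hp).2, hAprime hp⟩
  have hsmall : ∏ p ∈ Nat.primesLE ⌊L⌋₊, (1 - 1 / (p : ℝ)) ≤ ∏ p ∈ A, (1 - 1 / (p : ℝ)) := by
    rw [← Finset.prod_sdiff hsub]
    refine mul_le_of_le_one_left (Finset.prod_nonneg fun p hp => (hfac (hAprime hp)).1) ?_
    have hp' {p : ℕ} (hp : p ∈ Nat.primesLE ⌊L⌋₊ \ A) : p.Prime :=
      Nat.prime_of_mem_primesLE (Finset.mem_sdiff.1 hp).1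
    exact Finset.prod_le_one (fun p hp => (hfac (hp' hp)).1) fun p hp => (hfac (hp' hp)).2
  have hinvL : 1 / L < 1 := (div_lt_one hL0).2 hL
  have hlarge : 1 - 1 / log L ≤ ∏ p ∈ B, (1 - 1 / (p : ℝ)) := by
    calc 1 - 1 / log L ≤ 1 + (B.card : ℝ) * (-(1 / L)) := by
          have := card_primeFactors_gt_mul_log_le hn hL0
          have h2 : (B.card : ℝ) * (1 / L) ≤ 1 / log L := by
            rw [mul_one_div, div_le_div_iff₀ hL0 hlogL]
            linarith
          linarith
      _ ≤ (1 + -(1 / L)) ^ B.card := one_add_mul_le_pow (by linarith) _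
      _ = ∏ p ∈ B, (1 - 1 / L) := by rw [Finset.prod_const, ← sub_eq_add_neg]
      _ ≤ ∏ p ∈ B, (1 - 1 / (p : ℝ)) := by
          refine Finset.prod_le_prod (fun _ _ => by linarith) fun p hp => ?_
          have hp' : L < p := not_le.1 (Finset.mem_filter.1 hp).2
          have := one_div_le_one_div_of_le hL0 hp'.le
          linarith
  have hP0 : 0 ≤ ∏ p ∈ Nat.primesLE ⌊L⌋₊, (1 - 1 / (p : ℝ)) :=
    Finset.prod_nonneg fun p hp => (hfac (Nat.prime_of_mem_primesLE hp)).1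
  have hB0 : 0 ≤ ∏ p ∈ B, (1 - 1 / (p : ℝ)) := Finset.prod_nonneg fun p hp =>
    (hfac (Nat.prime_of_mem_primeFactors (Finset.mem_filter.1 hp).1)).1
  exact (mul_le_mul_of_nonneg_left hlarge hP0).trans (mul_le_mul_of_nonneg_right hsmall hB0)

theorem eventually_lt_totient_mul_loglog_div {a : ℝ} (ha : a < exp (-eulerMascheroniConstant)) :
    ∀ᶠ n : ℕ in atTop, a < (Nat.totient n : ℝ) * log (log n) / (n : ℝ) := by
  have hlog : Tendsto (fun n : ℕ => log (n : ℝ)) atTop atTop :=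
    tendsto_log_atTop.comp tendsto_natCast_atTop_atTop
  have h1 : Tendsto (fun n : ℕ => 1 - 1 / log (log (n : ℝ))) atTop (𝓝 (1 - 0)) :=
    ((tendsto_log_atTop.comp hlog).const_div_atTop 1).const_sub 1
  have h2 := (tendsto_prod_primesLE_one_sub_mul_log.comp hlog).mul h1
  rw [sub_zero, mul_one] at h2
  filter_upwards [h2.eventually (lt_mem_nhds ha), hlog.eventually_gt_atTop 1,
    eventually_ne_atTop 0] with n hn hL hn0
  refine hn.trans_le ?_
  have := mul_le_mul_of_nonneg_right (prod_primesLE_mul_le_totient_div_self hn0 hL)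
    (log_pos hL).le
  simp only [Function.comp_apply]
  linear_combination this

theorem totient_mul_loglog_div_primorial_le {k : ℕ} (hk : 2 ≤ k) :
    (Nat.totient (primorial k) : ℝ) * log (log (primorial k)) / (primorial k : ℝ) ≤
      (∏ p ∈ Nat.primesLE k, (1 - 1 / (p : ℝ))) * (log k + log (log 4)) := by
  have hk' : (2 : ℝ) ≤ k := mod_cast hk
  have hθ := Chebyshev.theta_eq_log_primorial (k : ℝ)
  rw [Nat.floor_natCast] at hθ
  have hlog : log (log (primorial k)) ≤ log k + log (log 4) := by
    have h4 : 0 < log 4 := log_pos (by norm_num)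
    rw [add_comm, ← log_mul h4.ne' (by linarith), ← hθ]
    exact log_le_log (Chebyshev.theta_pos hk') (Chebyshev.theta_le_log4_mul_x (by linarith))
  rw [mul_div_right_comm, totient_div_self_eq_prod (primorial_pos k).ne',
    primeFactors_primorial]
  refine mul_le_mul_of_nonneg_left hlog (Finset.prod_nonneg fun p hp => ?_)
  linarith [(Nat.prime_of_mem_primesLE hp).one_div_le_half]

theorem frequently_totient_mul_loglog_div_lt {b : ℝ} (hb : exp (-eulerMascheroniConstant) < b) :
    ∃ᶠ n : ℕ in atTop, (Nat.totient n : ℝ) * log (log n) / (n : ℝ) < b := by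
  have hlog : Tendsto (fun k : ℕ => log (k : ℝ)) atTop atTop :=
    tendsto_log_atTop.comp tendsto_natCast_atTop_atTop
  have h1 : Tendsto (fun k : ℕ => 1 + log (log 4) / log (k : ℝ)) atTop (𝓝 (1 + 0)) :=
    (hlog.const_div_atTop _).const_add 1
  have h2 := (tendsto_prod_primesLE_one_sub_mul_log.comp tendsto_natCast_atTop_atTop).mul h1
  rw [add_zero, mul_one] at h2
  obtain ⟨K, hK⟩ := (h2.eventually (gt_mem_nhds hb)).exists_forall_of_atTop
  refine frequently_atTop.2 fun N => ?_
  obtain ⟨k, hk, hkp⟩ := Nat.exists_infinite_primes (max K N)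
  have hk0 : 0 < log (k : ℝ) := log_pos (mod_cast hkp.one_lt)
  refine ⟨primorial k, ?_, (totient_mul_loglog_div_primorial_le hkp.two_le).trans_lt ?_⟩
  · refine (le_max_right K N).trans (hk.trans (Nat.le_of_dvd (primorial_pos k) ?_))
    rw [primorial_eq_prod_primesLE]
    exact Finset.dvd_prod_of_mem _ (Nat.mem_primesLE.2 ⟨le_rfl, hkp⟩)
  · have := hK k ((le_max_left K N).trans hk)
    simp only [Function.comp_apply, Nat.floor_natCast] at this
    rwa [mul_assoc, mul_add, mul_one, mul_div_cancel₀ _ hk0.ne'] at this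

theorem totient_liminf_loglog :
    liminf (fun n : ℕ => (Nat.totient n : ℝ) * Real.log (Real.log n) / (n : ℝ)) atTop
      = Real.exp (-Real.eulerMascheroniConstant) := by
  have hbdd : IsBoundedUnder (· ≥ ·) atTop
      (fun n : ℕ => (Nat.totient n : ℝ) * Real.log (Real.log n) / (n : ℝ)) :=
    ⟨_, eventually_map.2
      ((eventually_lt_totient_mul_loglog_div (sub_one_lt _)).mono fun _ h => h.le)⟩
  have hcobdd : IsCoboundedUnder (· ≥ ·) atTop
      (fun n : ℕ => (Nat.totient n : ℝ) * Real.log (Real.log n) / (n : ℝ)) :=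
    IsCoboundedUnder.of_frequently_le
      ((frequently_totient_mul_loglog_div_lt (lt_add_one _)).mono fun _ h => h.le)
  refine le_antisymm (le_of_forall_gt_imp_ge_of_dense fun b hb => ?_)
    (le_of_forall_lt_imp_le_of_dense fun a ha => ?_)
  · exact liminf_le_of_frequently_le
      ((frequently_totient_mul_loglog_div_lt hb).mono fun _ h => h.le) hbdd
  · exact le_liminf_of_le hcobdd
      ((eventually_lt_totient_mul_loglog_div ha).mono fun _ h => h.le)
end
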